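/- arXiv:2411.02520 — 2 statements merged into one kernel-verified Lean document; each statement's English description precedes it below -/
import Mathlib

section
/- For every ρ ∈ (−1,1), one has I_ρ(S₀,V₀,K) ≤ (1/(1−ρ²)) · J(V₀, K/η²(S₀)). -/
open MeasureTheory

/-- `f : [0,1] → ℝ` is absolutely continuous with square-integrable derivative `f'`. -/
def AC (f f' : ℝ → ℝ) : Prop :=
  IntervalIntegrable f' MeasureTheory.volume 0 1 ∧
  IntervalIntegrable (fun t => (f' t) ^ 2) MeasureTheory.volume 0 1 ∧
  ∀ t ∈ Set.Icc (0 : ℝ) 1, f t = f 0 + ∫ s in (0 : ℝ)..t, f' s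

/-- The functional `Λ_ρ[g,h]` (with chosen derivatives `g'`, `h'`). -/
noncomputable def Lam (η σ : ℝ → ℝ) (ρ : ℝ) (g g' h h' : ℝ → ℝ) : ℝ :=
  (1 / (2 * (1 - ρ ^ 2))) *
    (∫ t in (0 : ℝ)..1,
      (g' t / (η (Real.exp (g t)) * Real.sqrt (Real.exp (h t))) -
        ρ * h' t / σ (Real.exp (h t))) ^ 2) +
  (1 / 2) * (∫ t in (0 : ℝ)..1, (h' t / σ (Real.exp (h t))) ^ 2)

/-- Admissible values of the variational problem defining the rate function. -/
def RateValues (η σ : ℝ → ℝ) (ρ S₀ V₀ K : ℝ) : Set ℝ :=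
  {y | ∃ g g' h h' : ℝ → ℝ, AC g g' ∧ AC h h' ∧
    g 0 = Real.log S₀ ∧ h 0 = Real.log V₀ ∧
    (∫ t in (0 : ℝ)..1, Real.exp (h t) * (η (Real.exp (g t))) ^ 2) = K ∧
    y = Lam η σ ρ g g' h h'}

/-- The rate function `I_ρ(S₀,V₀,K)`. -/
noncomputable def RateI (η σ : ℝ → ℝ) (ρ S₀ V₀ K : ℝ) : ℝ :=
  sInf (RateValues η σ ρ S₀ V₀ K)

/-- Admissible values of the one-dimensional variational problem defining `J(V₀,z)`. -/
def JValues (σ : ℝ → ℝ) (V₀ z : ℝ) : Set ℝ :=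
  {y | ∃ h h' : ℝ → ℝ, AC h h' ∧ h 0 = Real.log V₀ ∧
    (∫ t in (0 : ℝ)..1, Real.exp (h t)) = z ∧
    y = (1 / 2) * (∫ t in (0 : ℝ)..1, (h' t / σ (Real.exp (h t))) ^ 2)}

/-- The function `J(V₀,z)`. -/
noncomputable def JFun (σ : ℝ → ℝ) (V₀ z : ℝ) : ℝ := sInf (JValues σ V₀ z)

lemma AC.const (c : ℝ) : AC (fun _ => c) (fun _ => 0) := by
  refine ⟨by simp, by simp, fun t _ => by simp⟩

lemma AC.of_hasDerivAt {f f' : ℝ → ℝ} (hf : ∀ t ∈ Set.Icc (0 : ℝ) 1, HasDerivAt f (f' t) t)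
    (hf' : ContinuousOn f' (Set.Icc 0 1)) : AC f f' := by
  have hu : Set.uIcc (0 : ℝ) 1 = Set.Icc 0 1 := Set.uIcc_of_le zero_le_one
  have hi : IntervalIntegrable f' volume 0 1 := (hu ▸ hf').intervalIntegrable
  refine ⟨hi, ContinuousOn.intervalIntegrable (hu ▸ hf'.pow 2), fun t ht => ?_⟩
  have hsub : Set.uIcc 0 t ⊆ Set.Icc (0 : ℝ) 1 := by
    rw [Set.uIcc_of_le ht.1]
    exact Set.Icc_subset_Icc_right ht.2
  rw [intervalIntegral.integral_eq_sub_of_hasDerivAt (fun s hs => hf s (hsub hs))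
    (hf'.mono hsub).intervalIntegrable]
  ring

/-- The path `h` with `exp (h t) = V₀ / (1 + c t)²`, where `1 + c = V₀ / z`, is admissible. -/
lemma JValues_nonempty (σ : ℝ → ℝ) {V₀ z : ℝ} (hV₀ : 0 < V₀) (hz : 0 < z) :
    (JValues σ V₀ z).Nonempty := by
  obtain ⟨c, hc⟩ : ∃ c, 1 + c = V₀ / z := ⟨V₀ / z - 1, by ring⟩
  have hc0 : 0 < 1 + c := hc ▸ div_pos hV₀ hz
  have hpos : ∀ t ∈ Set.Icc (0 : ℝ) 1, 0 < 1 + c * t := by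
    rintro t ⟨h0, h1⟩
    nlinarith [mul_nonneg h0 hc0.le]
  have hlin (t : ℝ) : HasDerivAt (fun t : ℝ => 1 + c * t) c t := by
    simpa using ((hasDerivAt_id t).const_mul c).const_add 1
  have hu : Set.uIcc (0 : ℝ) 1 = Set.Icc 0 1 := Set.uIcc_of_le zero_le_one
  refine ⟨_, fun t => Real.log V₀ - 2 * Real.log (1 + c * t), fun t => -(2 * (c / (1 + c * t))),
    AC.of_hasDerivAt (fun t ht => ?_) ?_, by simp, ?_, rfl⟩
  · exact (((hlin t).log (hpos t ht).ne').const_mul 2).const_sub _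
  · exact ((continuousOn_const.div (by fun_prop) fun t ht => (hpos t ht).ne').const_mul 2).neg
  · have hexp : ∀ t ∈ Set.uIcc (0 : ℝ) 1,
        Real.exp (Real.log V₀ - 2 * Real.log (1 + c * t)) = V₀ / (1 + c * t) ^ 2 := by
      intro t ht
      rw [Real.exp_sub, Real.exp_log hV₀, two_mul, Real.exp_add, Real.exp_log (hpos t (hu ▸ ht)),
        sq]
    rw [intervalIntegral.integral_congr hexp,
      intervalIntegral.integral_eq_sub_of_hasDerivAt (f := fun t => V₀ * t / (1 + c * t))]
    · simp only [mul_one, mul_zero, zero_div, sub_zero, hc]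
      field_simp
    · intro t ht
      have hne := (hpos t (hu ▸ ht)).ne'
      refine (((hasDerivAt_id t).const_mul V₀).div (hlin t) hne).congr_deriv ?_
      simp only [id]
      ring
    · refine ContinuousOn.intervalIntegrable (continuousOn_const.div (by fun_prop) fun t ht => ?_)
      exact pow_ne_zero 2 (hpos t (hu ▸ ht)).ne'

lemma Lam_nonneg (η σ : ℝ → ℝ) {ρ : ℝ} (hρ : 0 < 1 - ρ ^ 2) (g g' h h' : ℝ → ℝ) :
    0 ≤ Lam η σ ρ g g' h h' := by
  have hint (f : ℝ → ℝ) : 0 ≤ ∫ t in (0 : ℝ)..1, f t ^ 2 :=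
    intervalIntegral.integral_nonneg zero_le_one fun _ _ => sq_nonneg _
  exact add_nonneg (mul_nonneg (by positivity) (hint _)) (mul_nonneg (by norm_num) (hint _))

lemma Lam_zero_deriv (η σ : ℝ → ℝ) {ρ : ℝ} (hρ : 0 < 1 - ρ ^ 2) (g h h' : ℝ → ℝ) :
    Lam η σ ρ g (fun _ => 0) h h' =
      (1 / (1 - ρ ^ 2)) * ((1 / 2) * ∫ t in (0 : ℝ)..1, (h' t / σ (Real.exp (h t))) ^ 2) := by
  have hfun : (fun t => ((0 : ℝ) / (η (Real.exp (g t)) * Real.sqrt (Real.exp (h t))) -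
      ρ * h' t / σ (Real.exp (h t))) ^ 2) =
      fun t => ρ ^ 2 * (h' t / σ (Real.exp (h t))) ^ 2 := by
    funext t
    ring
  rw [Lam, hfun, intervalIntegral.integral_const_mul]
  field_simp
  ring

/-- For every `ρ ∈ (−1,1)`, `I_ρ(S₀,V₀,K) ≤ (1/(1−ρ²)) · J(V₀, K/η²(S₀))`. -/
theorem rateI_le_J_bound
    (S₀ V₀ K : ℝ) (hS₀ : 0 < S₀) (hV₀ : 0 < V₀) (hK : 0 < K)
    (η σ : ℝ → ℝ)
    (hηc : ContinuousOn η (Set.Ioi 0)) (hσc : ContinuousOn σ (Set.Ioi 0))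
    (mη Mη mσ Mσ : ℝ) (hmη : 0 < mη) (hmσ : 0 < mσ)
    (hηb : ∀ x ∈ Set.Ioi (0 : ℝ), mη ≤ η x ∧ η x ≤ Mη)
    (hσb : ∀ x ∈ Set.Ioi (0 : ℝ), mσ ≤ σ x ∧ σ x ≤ Mσ)
    (ρ : ℝ) (hρ : ρ ∈ Set.Ioo (-1 : ℝ) 1) :
    RateI η σ ρ S₀ V₀ K ≤ (1 / (1 - ρ ^ 2)) * JFun σ V₀ (K / (η S₀) ^ 2) := by
  have hρ2 : 0 < 1 - ρ ^ 2 := by nlinarith [hρ.1, hρ.2]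
  have hη : 0 < η S₀ := hmη.trans_le (hηb S₀ hS₀).1
  have hbdd : BddBelow (RateValues η σ ρ S₀ V₀ K) := by
    refine ⟨0, ?_⟩
    rintro _ ⟨g, g', h, h', -, -, -, -, -, rfl⟩
    exact Lam_nonneg η σ hρ2 g g' h h'
  rw [one_div, ← div_eq_inv_mul, le_div_iff₀ hρ2]
  refine le_csInf (JValues_nonempty σ hV₀ (by positivity)) ?_
  rintro _ ⟨h, h', hAC, h0, hz, rfl⟩
  rw [← le_div_iff₀ hρ2, div_eq_inv_mul, ← one_div, ← Lam_zero_deriv η σ hρ2 (fun _ => Real.log S₀)]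
  refine csInf_le hbdd ⟨_, _, h, h', AC.const _, hAC, rfl, h0, ?_, rfl⟩
  simp only [Real.exp_log hS₀]
  rw [intervalIntegral.integral_mul_const, hz]
  field_simp
end

section
/- Fix a sign ε ∈ {+1, −1} and let F_ε : (0,∞) → (0,∞) satisfy ∫_{S₀}^{F_ε(x)} dy/(y η(y)) = ε ∫_{V₀}^{x} dy/(√y σ(y)) for every x > 0. Define I_ε(S₀,V₀,K) as the infimum of (1/2) ∫₀¹ ( h'(t)/σ(e^{h(t)}) )² dt over all pairs of absolutely continuous functions g, h : [0,1] → ℝ with square-integrable derivatives such that g(0) = log S₀, h(0) = log V₀, ∫₀¹ e^{h(t)} η²(e^{g(t)}) dt = K, and g'(t)/(η(e^{g(t)}) √(e^{h(t)})) = ε h'(t)/σ(e^{h(t)}) for almost every t ∈ [0,1]. Then I_ε(S₀,V₀,K) = inf { (1/2) ∫₀¹ ( h'(t)/σ(e^{h(t)}) )² dt : h : [0,1] → ℝ absolutely continuous with square-integrable derivative, h(0) = log V₀, ∫₀¹ e^{h(t)} η²(F_ε(e^{h(t)})) dt = K }. -/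
open MeasureTheory

/-- A Lipschitz function of an absolutely continuous function is absolutely continuous. -/
theorem LipschitzOnWith.comp_absolutelyContinuousOnInterval {X Y : Type*} [PseudoMetricSpace X]
    [PseudoMetricSpace Y] {φ : X → Y} {f : ℝ → X} {a b : ℝ} {C : NNReal} {s : Set X}
    (hφ : LipschitzOnWith C φ s) (hf : AbsolutelyContinuousOnInterval f a b)
    (hs : Set.MapsTo f (Set.uIcc a b) s) :
    AbsolutelyContinuousOnInterval (fun t => φ (f t)) a b := by
  rw [absolutelyContinuousOnInterval_iff] at hf ⊢
  intro ε hε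
  obtain ⟨δ, hδ, H⟩ := hf (ε / (C + 1)) (by positivity)
  refine ⟨δ, hδ, fun E hE hEδ => ?_⟩
  calc ∑ i ∈ Finset.range E.1, dist (φ (f (E.2 i).1)) (φ (f (E.2 i).2))
      ≤ ∑ i ∈ Finset.range E.1, C * dist (f (E.2 i).1) (f (E.2 i).2) :=
        Finset.sum_le_sum fun i hi =>
          hφ.dist_le_mul _ (hs (hE.1 i hi).1) _ (hs (hE.1 i hi).2)
    _ = C * ∑ i ∈ Finset.range E.1, dist (f (E.2 i).1) (f (E.2 i).2) := by
        rw [Finset.mul_sum]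
    _ ≤ C * (ε / (C + 1)) := by gcongr; exact (H E hE hEδ).le
    _ < (C + 1) * (ε / (C + 1)) := by gcongr; linarith
    _ = ε := by field

/-- A `C¹` function of an absolutely continuous function is absolutely continuous. -/
theorem ContDiff.comp_absolutelyContinuousOnInterval {φ f : ℝ → ℝ} {a b : ℝ}
    (hφ : ContDiff ℝ 1 φ) (hf : AbsolutelyContinuousOnInterval f a b) :
    AbsolutelyContinuousOnInterval (fun t => φ (f t)) a b := by
  obtain ⟨M, hM⟩ := hf.exists_bound
  obtain ⟨C, hC⟩ := hφ.contDiffOn.exists_lipschitzOnWith one_ne_zero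
    (convex_closedBall (0 : ℝ) M) (isCompact_closedBall 0 M)
  exact hC.comp_absolutelyContinuousOnInterval hf fun t ht => by simpa using hM t ht

theorem contDiff_one_of_hasDerivAt {φ φ' : ℝ → ℝ} (hφ : ∀ x, HasDerivAt φ (φ' x) x)
    (hφ' : Continuous φ') : ContDiff ℝ 1 φ := by
  rw [contDiff_one_iff_deriv, funext fun x => (hφ x).deriv]
  exact ⟨fun x => (hφ x).differentiableAt, hφ'⟩

theorem AC.continuousOn {f f' : ℝ → ℝ} (hf : AC f f') : ContinuousOn f (Set.Icc 0 1) := by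
  have h := intervalIntegral.continuousOn_primitive_interval' hf.1 Set.left_mem_uIcc
  rw [Set.uIcc_of_le zero_le_one] at h
  exact (continuousOn_const.add h).congr hf.2.2

/-- The chain rule, in integrated form, for a `C¹` function of an absolutely continuous one. -/
theorem AC.comp_eq_add_integral {f f' φ φ' : ℝ → ℝ} (hf : AC f f')
    (hφ : ∀ x, HasDerivAt φ (φ' x) x) (hφ' : Continuous φ') {t : ℝ}
    (ht : t ∈ Set.Icc (0 : ℝ) 1) :
    φ (f t) = φ (f 0) + ∫ s in (0 : ℝ)..t, φ' (f s) * f' s := by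
  obtain ⟨hi, -, hrep⟩ := hf
  have hsub : Set.uIcc 0 t ⊆ Set.uIcc (0 : ℝ) 1 := by
    rw [Set.uIcc_of_le ht.1, Set.uIcc_of_le zero_le_one]
    exact Set.Icc_subset_Icc_right ht.2
  have hit : IntervalIntegrable f' volume 0 t := hi.mono_set hsub
  set F : ℝ → ℝ := fun s => f 0 + ∫ r in (0 : ℝ)..s, f' r with hF
  have hFf : ∀ s ∈ Set.uIcc 0 t, f s = F s := fun s hs =>
    hrep s (by simpa only [Set.uIcc_of_le zero_le_one] using hsub hs)
  have hFac : AbsolutelyContinuousOnInterval F 0 t :=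
    (LipschitzOnWith.absolutelyContinuousOnInterval
      (LipschitzWith.const (f 0)).lipschitzOnWith).add
      (hit.absolutelyContinuousOnInterval_intervalIntegral Set.left_mem_uIcc)
  have hftc := ((contDiff_one_of_hasDerivAt hφ hφ').comp_absolutelyContinuousOnInterval
    hFac).integral_deriv_eq_sub
  have hcongr : ∫ s in (0 : ℝ)..t, deriv (fun s => φ (F s)) s =
      ∫ s in (0 : ℝ)..t, φ' (f s) * f' s := by
    refine intervalIntegral.integral_congr_ae ?_
    filter_upwards [hit.ae_hasDerivAt_integral] with s hs hst
    have hst' := Set.uIoc_subset_uIcc hst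
    rw [hFf s hst']
    exact ((hφ (F s)).comp s ((hs hst' 0 Set.left_mem_uIcc).const_add (f 0))).deriv
  rw [hFf t Set.right_mem_uIcc, hFf 0 Set.left_mem_uIcc, ← hcongr, hftc]
  ring

/-- A `C¹` function of an absolutely continuous function with square-integrable derivative is
again of this kind. -/
theorem AC.comp {f f' φ φ' : ℝ → ℝ} (hf : AC f f')
    (hφ : ∀ x, HasDerivAt φ (φ' x) x) (hφ' : Continuous φ') :
    AC (fun t => φ (f t)) (fun t => φ' (f t) * f' t) := by
  have hc : ContinuousOn (fun t => φ' (f t)) (Set.uIcc 0 1) := by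
    rw [Set.uIcc_of_le zero_le_one]
    exact hφ'.comp_continuousOn hf.continuousOn
  refine ⟨hf.1.continuousOn_mul hc, ?_, fun t ht => hf.comp_eq_add_integral hφ hφ' ht⟩
  simp only [mul_pow]
  exact hf.2.1.continuousOn_mul (hc.pow 2)

/-- Differentiability of a function defined implicitly by `A (G v) = B v`. -/
theorem HasDerivAt.of_comp_eq {A a B G : ℝ → ℝ} {b v : ℝ} (hA : ∀ x, HasDerivAt A (a x) x)
    (ha : Continuous a) (ha0 : ∀ x, a x ≠ 0) (hinj : Function.Injective A)
    (hB : HasDerivAt B b v) (hG : ∀ v, A (G v) = B v) :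
    HasDerivAt G ((a (G v))⁻¹ * b) v := by
  have hstrict : HasStrictDerivAt A (a (G v)) (G v) :=
    hasStrictDerivAt_of_hasDerivAt_of_continuousAt (.of_forall hA) ha.continuousAt
  have hinv := (hstrict.to_local_left_inverse (ha0 _)
    (.of_forall (Function.leftInverse_invFun hinj))).hasDerivAt
  rw [hG v] at hinv
  have hcomp : G = Function.invFun A ∘ B := by
    ext w
    rw [Function.comp_apply, ← hG w, Function.leftInverse_invFun hinj]
  rw [hcomp] at hinv ⊢
  exact hinv.comp v hB

/-- The fundamental theorem of calculus on `(0,∞)` in the logarithmic variable. -/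
theorem hasDerivAt_integral_exp {p : ℝ → ℝ} (hp : ContinuousOn p (Set.Ioi 0)) {c : ℝ}
    (hc : 0 < c) (u : ℝ) :
    HasDerivAt (fun u => ∫ y in c..Real.exp u, p y) (p (Real.exp u) * Real.exp u) u := by
  have hu := Real.exp_pos u
  have hsub : Set.uIcc c (Real.exp u) ⊆ Set.Ioi 0 := Set.ordConnected_Ioi.uIcc_subset hc hu
  have h := intervalIntegral.integral_hasDerivAt_right (hp.mono hsub).intervalIntegrable
    (hp.stronglyMeasurableAtFilter isOpen_Ioi _ hu) (hp.continuousAt (Ioi_mem_nhds hu))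
  exact h.comp u (Real.hasDerivAt_exp u)

/-- For `ε = ±1` and `F_ε` satisfying
`∫_{S₀}^{F_ε(x)} dy/(y η(y)) = ε ∫_{V₀}^{x} dy/(√y σ(y))` for all `x > 0`, the infimum
of `(1/2)∫₀¹ (h'/σ(e^h))²` over pairs `(g,h)` satisfying the constraint
`g'/(η(e^g)√(e^h)) = ε h'/σ(e^h)` a.e. equals the corresponding one-dimensional infimum. -/
theorem perfectly_correlated_variational_eq
    (S₀ V₀ K : ℝ) (hS₀ : 0 < S₀) (hV₀ : 0 < V₀) (hK : 0 < K)
    (η σ : ℝ → ℝ)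
    (hηc : ContinuousOn η (Set.Ioi 0)) (hσc : ContinuousOn σ (Set.Ioi 0))
    (mη Mη mσ Mσ : ℝ) (hmη : 0 < mη) (hmσ : 0 < mσ)
    (hηb : ∀ x ∈ Set.Ioi (0 : ℝ), mη ≤ η x ∧ η x ≤ Mη)
    (hσb : ∀ x ∈ Set.Ioi (0 : ℝ), mσ ≤ σ x ∧ σ x ≤ Mσ)
    (ε : ℝ) (hε : ε = 1 ∨ ε = -1)
    (F : ℝ → ℝ) (hFpos : ∀ x, 0 < x → 0 < F x)
    (hF : ∀ x, 0 < x →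
      (∫ y in S₀..F x, 1 / (y * η y)) = ε * ∫ y in V₀..x, 1 / (Real.sqrt y * σ y)) :
    sInf {y | ∃ g g' h h' : ℝ → ℝ, AC g g' ∧ AC h h' ∧
        g 0 = Real.log S₀ ∧ h 0 = Real.log V₀ ∧
        (∫ t in (0 : ℝ)..1, Real.exp (h t) * (η (Real.exp (g t))) ^ 2) = K ∧
        (∀ᵐ t ∂(MeasureTheory.volume.restrict (Set.Icc (0 : ℝ) 1)),
          g' t / (η (Real.exp (g t)) * Real.sqrt (Real.exp (h t))) =
            ε * h' t / σ (Real.exp (h t))) ∧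
        y = (1 / 2) * (∫ t in (0 : ℝ)..1, (h' t / σ (Real.exp (h t))) ^ 2)} =
      sInf {y | ∃ h h' : ℝ → ℝ, AC h h' ∧ h 0 = Real.log V₀ ∧
        (∫ t in (0 : ℝ)..1, Real.exp (h t) * (η (F (Real.exp (h t)))) ^ 2) = K ∧
        y = (1 / 2) * (∫ t in (0 : ℝ)..1, (h' t / σ (Real.exp (h t))) ^ 2)} := by
  have hexp : ∀ {p : ℝ → ℝ}, ContinuousOn p (Set.Ioi 0) → Continuous fun u => p (Real.exp u) :=
    fun hp => hp.comp_continuous Real.continuous_exp Real.exp_pos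
  have hηpos : ∀ x, 0 < x → 0 < η x := fun x hx => hmη.trans_le (hηb x hx).1
  have hσpos : ∀ x, 0 < x → 0 < σ x := fun x hx => hmσ.trans_le (hσb x hx).1
  have hη0 : ∀ u, 0 < η (Real.exp u) := fun u => hηpos _ (Real.exp_pos u)
  have hσ0 : ∀ u, 0 < σ (Real.exp u) := fun u => hσpos _ (Real.exp_pos u)
  have hε0 : ε ≠ 0 := by rcases hε with rfl | rfl <;> norm_num
  set a : ℝ → ℝ := fun u => (η (Real.exp u))⁻¹ with ha
  set b : ℝ → ℝ := fun v => ε * (Real.sqrt (Real.exp v) / σ (Real.exp v)) with hb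
  set A : ℝ → ℝ := fun u => ∫ y in S₀..Real.exp u, 1 / (y * η y) with hAdef
  set B : ℝ → ℝ := fun v => ε * ∫ y in V₀..Real.exp v, 1 / (Real.sqrt y * σ y) with hBdef
  set G : ℝ → ℝ := fun v => Real.log (F (Real.exp v)) with hG
  have ha_pos : ∀ u, 0 < a u := fun u => inv_pos.2 (hη0 u)
  have ha_cont : Continuous a := (hexp hηc).inv₀ fun u => (hη0 u).ne'
  have hb_cont : Continuous b :=
    continuous_const.mul (Real.continuous_exp.sqrt.div (hexp hσc) fun u => (hσ0 u).ne')
  have hA : ∀ u, HasDerivAt A (a u) u := fun u => by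
    have hp : ContinuousOn (fun y => 1 / (y * η y)) (Set.Ioi 0) :=
      continuousOn_const.div (continuousOn_id.mul hηc) fun y hy => (mul_pos hy (hηpos y hy)).ne'
    refine (hasDerivAt_integral_exp hp hS₀ u).congr_deriv ?_
    have := (hη0 u).ne'
    have := (Real.exp_pos u).ne'
    simp only [ha]
    field_simp
  have hB : ∀ v, HasDerivAt B (b v) v := fun v => by
    have hp : ContinuousOn (fun y => 1 / (Real.sqrt y * σ y)) (Set.Ioi 0) :=
      continuousOn_const.div (Real.continuous_sqrt.continuousOn.mul hσc)
        fun y hy => (mul_pos (Real.sqrt_pos.2 hy) (hσpos y hy)).ne'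
    refine ((hasDerivAt_integral_exp hp hV₀ v).const_mul ε).congr_deriv ?_
    have h1 := (hσ0 v).ne'
    have h2 := (Real.sqrt_pos.2 (Real.exp_pos v)).ne'
    have h3 := Real.mul_self_sqrt (Real.exp_pos v).le
    simp only [hb]
    congr 1
    field_simp
    rw [sq, h3]
  have hA_inj : Function.Injective A :=
    (strictMono_of_hasDerivAt_pos hA ha_pos).injective
  have hexpG : ∀ v, Real.exp (G v) = F (Real.exp v) := fun v =>
    Real.exp_log (hFpos _ (Real.exp_pos v))
  have hAG : ∀ v, A (G v) = B v := fun v => by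
    simp only [hAdef, hBdef, hexpG]
    exact hF _ (Real.exp_pos v)
  have hA_log : A (Real.log S₀) = 0 := by simp [hAdef, Real.exp_log hS₀]
  have hB_log : B (Real.log V₀) = 0 := by simp [hBdef, Real.exp_log hV₀]
  congr 1
  ext y
  constructor
  · rintro ⟨g, g', h, h', hg, hh, hg0, hh0, hK', hcon, rfl⟩
    refine ⟨h, h', hh, hh0, ?_, rfl⟩
    rw [← hK']
    refine intervalIntegral.integral_congr fun t ht => ?_
    rw [Set.uIcc_of_le zero_le_one] at ht
    have hgG : g t = G (h t) := by
      refine hA_inj ?_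
      rw [hAG, hg.comp_eq_add_integral hA ha_cont ht, hh.comp_eq_add_integral hB hb_cont ht,
        hg0, hh0, hA_log, hB_log]
      congr 1
      refine intervalIntegral.integral_congr_ae ?_
      rw [ae_restrict_iff' measurableSet_Icc] at hcon
      filter_upwards [hcon] with s hs hst
      rw [Set.uIoc_of_le ht.1] at hst
      have hs := hs ⟨hst.1.le, hst.2.trans ht.2⟩
      have h1 := (hη0 (g s)).ne'
      have h2 := (hσ0 (h s)).ne'
      have h3 := (Real.sqrt_pos.2 (Real.exp_pos (h s))).ne'
      simp only [ha, hb]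
      field_simp at hs ⊢
      linear_combination hs
    simp only [hgG, hexpG]
  · rintro ⟨h, h', hh, hh0, hK', rfl⟩
    have hGd : ∀ v, HasDerivAt G ((a (G v))⁻¹ * b v) v := fun v =>
      .of_comp_eq hA ha_cont (fun u => (ha_pos u).ne') hA_inj (hB v) hAG
    have hG_cont : Continuous G :=
      continuous_iff_continuousAt.2 fun v => (hGd v).continuousAt
    have hGd_cont : Continuous fun v => (a (G v))⁻¹ * b v :=
      ((ha_cont.comp hG_cont).inv₀ fun v => (ha_pos _).ne').mul hb_cont
    refine ⟨fun t => G (h t), _, h, h', hh.comp hGd hGd_cont, hh, ?_, hh0, ?_, ?_, rfl⟩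
    · refine hA_inj ?_
      simp only [hAG, hh0, hA_log, hB_log]
    · simpa only [hexpG] using hK'
    · refine .of_forall fun t => ?_
      have h1 := (hη0 (G (h t))).ne'
      have h2 := (hσ0 (h t)).ne'
      have h3 := (Real.sqrt_pos.2 (Real.exp_pos (h t))).ne'
      simp only [ha, hb, inv_inv]
      field_simp
end
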